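/- Let (B, L) be a Banach SN space with Banach SN dual (B*, L̃), set Λ := −L̃, and let A be a closed linear L-positive subspace of B. Then the following four conditions are equivalent: (i) A⁰ is Λ-positive; (ii) A is maximally L-positive and, for all c* ∈ B*, inf_{a ∈ A} q_{L̃}(La − c*) ≤ 0; (iii) for all c* ∈ B*, inf_{a ∈ A} q_{L̃}(La − c*) ≤ 0; (iv) A⁰ is maximally Λ-positive. -/

import Mathlib

open NormedSpace

variable {B : Type*} [NormedAddCommGroup B] [NormedSpace ℝ B]

/-- `L : B → B*` is an SN ("symmetric nonexpansive") map: `‖L‖ ≤ 1` and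
`⟨b, Lc⟩ = ⟨c, Lb⟩` for all `b, c ∈ B`. -/
def IsSNMap (L : B →L[ℝ] StrongDual ℝ B) : Prop :=
  ‖L‖ ≤ 1 ∧ ∀ b c : B, L c b = L b c

/-- The quadratic form `q_L(b) := (1/2)⟨b, Lb⟩` of an SN map. -/
noncomputable def qL (L : B →L[ℝ] StrongDual ℝ B) (b : B) : ℝ :=
  (1 / 2) * L b b

/-- `A ⊆ B` is `L`-positive: `A ≠ ∅` and `q_L(b - c) ≥ 0` for all `b, c ∈ A`. -/
def LPos (L : B →L[ℝ] StrongDual ℝ B) (A : Set B) : Prop :=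
  A.Nonempty ∧ ∀ b ∈ A, ∀ c ∈ A, 0 ≤ qL L (b - c)

/-- `A` is maximally `L`-positive: it is `L`-positive and not properly contained in
any other `L`-positive subset of `B`. -/
def MaxLPos (L : B →L[ℝ] StrongDual ℝ B) (A : Set B) : Prop :=
  LPos L A ∧ ∀ C : Set B, LPos L C → A ⊆ C → C = A

/-- The polar subspace `A⁰ := {b* ∈ B* : ⟨a, b*⟩ = 0 for all a ∈ A}`. -/
def polarSet (A : Set B) : Set (StrongDual ℝ B) :=
  {f | ∀ a ∈ A, f a = 0}

/-- `(B*, L')` is a Banach SN dual of `(B, L)`: `L'` is an SN map on `B*` and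
`⟨Lb, L'b*⟩ = ⟨b, b*⟩` for all `b ∈ B`, `b* ∈ B*`. -/
def IsSNDual (L : B →L[ℝ] StrongDual ℝ B) (L' : StrongDual ℝ B →L[ℝ] StrongDual ℝ (StrongDual ℝ B)) : Prop :=
  IsSNMap L' ∧ ∀ (b : B) (b' : StrongDual ℝ B), L' b' (L b) = b' b

set_option maxSynthPendingDepth 3

lemma abs_apply_le_of_isSNMap {L : B →L[ℝ] StrongDual ℝ B} (hL : IsSNMap L) (b c : B) :
    |L b c| ≤ ‖b‖ * ‖c‖ := by
  have h := L.le_of_opNorm_le hL.1 b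
  rw [one_mul] at h
  exact ((L b).le_opNorm c).trans (by gcongr)

lemma qL_add {L : B →L[ℝ] StrongDual ℝ B} (hL : IsSNMap L) (b c : B) :
    qL L (b + c) = qL L b + L b c + qL L c := by
  simp only [qL, map_add, add_apply, hL.2 b c]
  ring

lemma qL_neg (L : B →L[ℝ] StrongDual ℝ B) (b : B) : qL L (-b) = qL L b := by
  simp [qL]

lemma qL_smul (L : B →L[ℝ] StrongDual ℝ B) (t : ℝ) (b : B) : qL L (t • b) = t ^ 2 * qL L b := by
  simp only [qL, map_smul, smul_apply, smul_eq_mul]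
  ring

lemma abs_qL_le {L : B →L[ℝ] StrongDual ℝ B} (hL : IsSNMap L) (b : B) :
    |qL L b| ≤ ‖b‖ ^ 2 / 2 := by
  have h := abs_apply_le_of_isSNMap hL b b
  rw [qL, abs_mul, abs_of_pos (by norm_num : (0 : ℝ) < 1 / 2)]
  linarith [pow_two ‖b‖]

lemma qL_dual_apply {L : B →L[ℝ] StrongDual ℝ B}
    {L' : StrongDual ℝ B →L[ℝ] StrongDual ℝ (StrongDual ℝ B)} (hdual : IsSNDual L L') (b : B) :
    qL L' (L b) = qL L b := by
  rw [qL, qL, hdual.2]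

lemma qL_dual_add {L : B →L[ℝ] StrongDual ℝ B}
    {L' : StrongDual ℝ B →L[ℝ] StrongDual ℝ (StrongDual ℝ B)} (hdual : IsSNDual L L')
    (b : B) (f : StrongDual ℝ B) : qL L' (L b + f) = qL L b + f b + qL L' f := by
  rw [qL_add hdual.1, qL_dual_apply hdual, hdual.1.2 f (L b), hdual.2]

lemma qL_dual_sub {L : B →L[ℝ] StrongDual ℝ B}
    {L' : StrongDual ℝ B →L[ℝ] StrongDual ℝ (StrongDual ℝ B)} (hdual : IsSNDual L L')
    (b : B) (f : StrongDual ℝ B) : qL L' (L b - f) = qL L b - f b + qL L' f := by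
  rw [sub_eq_add_neg, qL_dual_add hdual, qL_neg, neg_apply, sub_eq_add_neg]

lemma qL_neg_map (L : B →L[ℝ] StrongDual ℝ B) (b : B) : qL (-L) b = -qL L b := by
  simp [qL]

lemma LPos.qL_nonneg {L : B →L[ℝ] StrongDual ℝ B} {A : Submodule ℝ B}
    (h : LPos L (A : Set B)) {a : B} (ha : a ∈ A) : 0 ≤ qL L a := by
  simpa using h.2 a ha 0 A.zero_mem

lemma lPos_neg_polarSet_iff (L' : StrongDual ℝ B →L[ℝ] StrongDual ℝ (StrongDual ℝ B))
    (A : Set B) : LPos (-L') (polarSet A) ↔ ∀ p ∈ polarSet A, qL L' p ≤ 0 := by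
  constructor
  · intro h p hp
    have := h.2 p hp 0 (fun a _ => rfl)
    rw [sub_zero, qL_neg_map] at this
    linarith
  · intro h
    refine ⟨⟨0, fun a _ => rfl⟩, fun p hp r hr => ?_⟩
    rw [qL_neg_map]
    have := h (p - r) (fun a ha => by simp [hp a ha, hr a ha])
    linarith

lemma sInf_image_nonpos_iff {α : Type*} {S : Set α} (hS : S.Nonempty) (F : α → ℝ) :
    sInf (F '' S) ≤ 0 ↔ ∀ ε > 0, ∃ a ∈ S, F a < ε := by
  constructor
  · intro h ε hε
    obtain ⟨_, ⟨a, ha, rfl⟩, h2⟩ := exists_lt_of_csInf_lt (hS.image F) (h.trans_lt hε)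
    exact ⟨a, ha, h2⟩
  · intro h
    by_cases hb : BddBelow (F '' S)
    · refine le_of_forall_pos_le_add fun ε hε => ?_
      obtain ⟨a, ha, h2⟩ := h ε hε
      linarith [csInf_le hb ⟨a, ha, rfl⟩]
    · exact (Real.sInf_of_not_bddBelow hb).le

/-- Tikhonov regularization: every functional `c` splits as `L a + e + p` with `p ∈ A⁰`, where `a`
almost minimizes `q_L - c + (r / 2) ‖·‖²` on `A` and `e` is almost a subgradient of
`(r / 2) ‖·‖²` at `a`. -/
lemma exists_regularized_decomposition {L : B →L[ℝ] StrongDual ℝ B} (hL : IsSNMap L)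
    {A : Submodule ℝ B} (hA : LPos L (A : Set B)) (c : StrongDual ℝ B) {r s : ℝ}
    (hr : 0 < r) (hr1 : r ≤ 1) (hs : 0 < s) :
    ∃ a ∈ A, ∃ e : StrongDual ℝ B, c - L a - e ∈ polarSet (A : Set B) ∧
      ‖e‖ ≤ r * ‖a‖ + 2 * s ∧ (r - s) * ‖a‖ ^ 2 - s ≤ e a ∧
      ∀ a' ∈ A, qL L a - c a + r / 2 * ‖a‖ ^ 2 ≤ qL L a' - c a' + r / 2 * ‖a'‖ ^ 2 + s ^ 2 := by
  set G : B → ℝ := fun a => qL L a - c a + r / 2 * ‖a‖ ^ 2 with hG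
  have hbdd : BddBelow (G '' (A : Set B)) := by
    refine ⟨-(‖c‖ ^ 2 / (2 * r)), ?_⟩
    rintro _ ⟨a, ha, rfl⟩
    have h1 := hA.qL_nonneg ha
    have h2 := (le_abs_self _).trans (c.le_opNorm a)
    have h3 : 0 ≤ (r * ‖a‖ - ‖c‖) ^ 2 / (2 * r) := by positivity
    have h4 : (r * ‖a‖ - ‖c‖) ^ 2 / (2 * r) =
        r / 2 * ‖a‖ ^ 2 - ‖c‖ * ‖a‖ + ‖c‖ ^ 2 / (2 * r) := by
      field_simp
      ring
    simp only [hG]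
    linarith
  obtain ⟨_, ⟨a, ha, rfl⟩, hlt⟩ := Real.lt_sInf_add_pos
    (show (G '' (A : Set B)).Nonempty from ⟨_, 0, A.zero_mem, rfl⟩) (by positivity : 0 < s ^ 2)
  have hmin : ∀ a' ∈ A, G a ≤ G a' + s ^ 2 := fun a' ha' => by
    linarith [csInf_le hbdd ⟨a', ha', rfl⟩]
  have hvar : ∀ u ∈ A, (c - L a) u ≤ qL L u + r / 2 * (‖a + u‖ ^ 2 - ‖a‖ ^ 2) + s ^ 2 := by
    intro u hu
    have h := hmin (a + u) (A.add_mem ha hu)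
    simp only [hG, qL_add hL, map_add] at h
    rw [sub_apply]
    linarith
  have hone : ∀ d ∈ A, (c - L a) d ≤ (r * ‖a‖ + 2 * s) * ‖d‖ := by
    intro d hd
    rcases eq_or_ne d 0 with rfl | hd0
    · simp
    have hdpos : 0 < ‖d‖ := norm_pos_iff.2 hd0
    have hu := hvar ((s / ‖d‖) • d) (A.smul_mem _ hd)
    have hun : ‖(s / ‖d‖) • d‖ = s := by
      rw [norm_smul, Real.norm_of_nonneg (by positivity), div_mul_cancel₀ _ hdpos.ne']
    have hq := (le_abs_self _).trans (abs_qL_le hL ((s / ‖d‖) • d))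
    have hadd := norm_add_le a ((s / ‖d‖) • d)
    rw [hun] at hq hadd
    have hsq : ‖a + (s / ‖d‖) • d‖ ^ 2 ≤ (‖a‖ + s) ^ 2 := by gcongr
    have hrs : r / 2 * (‖a + (s / ‖d‖) • d‖ ^ 2 - ‖a‖ ^ 2) ≤ r / 2 * ((‖a‖ + s) ^ 2 - ‖a‖ ^ 2) := by
      gcongr
    have hs2 : r * s ^ 2 ≤ 1 * s ^ 2 := by gcongr
    have hfin : s / ‖d‖ * (c - L a) d ≤ s * (r * ‖a‖ + 2 * s) := by
      rw [map_smul, smul_eq_mul] at hu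
      linarith
    have hmul := mul_le_mul_of_nonneg_left hfin (by positivity : 0 ≤ ‖d‖ / s)
    have e1 : ‖d‖ / s * (s / ‖d‖ * (c - L a) d) = (c - L a) d := by field_simp
    have e2 : ‖d‖ / s * (s * (r * ‖a‖ + 2 * s)) = (r * ‖a‖ + 2 * s) * ‖d‖ := by field_simp
    rwa [e1, e2] at hmul
  obtain ⟨e, he, hen⟩ := exists_extension_norm_eq A ((c - L a).comp A.subtypeL)
  have heA : ∀ d ∈ A, e d = (c - L a) d := fun d hd => he ⟨d, hd⟩
  refine ⟨a, ha, e, fun d hd => ?_, ?_, ?_, hmin⟩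
  · rw [sub_apply, heA d hd, sub_self]
  · rw [hen]
    refine ContinuousLinearMap.opNorm_le_bound _ (by positivity) fun d => ?_
    refine abs_le.2 ⟨?_, hone d d.2⟩
    have h := hone (-d) (A.neg_mem d.2)
    rw [map_neg, norm_neg] at h
    change -((r * ‖a‖ + 2 * s) * ‖(d : B)‖) ≤ (c - L a) d
    linarith
  · have h := hvar ((-s) • a) (A.smul_mem _ ha)
    have hn : ‖a + (-s) • a‖ ^ 2 = (1 - s) ^ 2 * ‖a‖ ^ 2 := by
      rw [show a + (-s) • a = (1 - s) • a by module, norm_smul, mul_pow, Real.norm_eq_abs, sq_abs]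
    rw [hn, qL_smul, map_smul, smul_eq_mul, ← heA a ha] at h
    have hq := (le_abs_self _).trans (abs_qL_le hL a)
    have h1 : s ^ 2 * qL L a ≤ s ^ 2 * (‖a‖ ^ 2 / 2) := by gcongr
    have h2 : r * (s ^ 2 * ‖a‖ ^ 2) ≤ 1 * (s ^ 2 * ‖a‖ ^ 2) := by gcongr
    refine le_of_mul_le_mul_left ?_ hs
    linarith

lemma exists_qL_dual_lt_of_polar_nonpos {L : B →L[ℝ] StrongDual ℝ B}
    {L' : StrongDual ℝ B →L[ℝ] StrongDual ℝ (StrongDual ℝ B)} (hL : IsSNMap L)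
    (hdual : IsSNDual L L') {A : Submodule ℝ B} (hA : LPos L (A : Set B))
    (hpolar : ∀ p ∈ polarSet (A : Set B), qL L' p ≤ 0) (c : StrongDual ℝ B) {ε : ℝ} (hε : 0 < ε) :
    ∃ a ∈ (A : Set B), qL L' (L a - c) < ε := by
  by_contra! hcon
  set Q : B → ℝ := fun a => qL L' (L a - c) with hQ
  have hbdd : BddBelow (Q '' (A : Set B)) := ⟨ε, by rintro _ ⟨a, ha, rfl⟩; exact hcon a ha⟩
  have hc := norm_nonneg c
  obtain ⟨σ, hσ, hσ1, hσε⟩ : ∃ σ : ℝ, 0 < σ ∧ σ ≤ 1 ∧ 25 * σ * (‖c‖ + 1) < ε := by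
    refine ⟨ε / (25 * (‖c‖ + 1) + ε), by positivity, ?_, ?_⟩
    · rw [div_le_one (by positivity)]
      linarith
    · rw [show 25 * (ε / (25 * (‖c‖ + 1) + ε)) * (‖c‖ + 1) =
        ε * (25 * (‖c‖ + 1)) / (25 * (‖c‖ + 1) + ε) by ring, div_lt_iff₀ (by positivity)]
      nlinarith
  obtain ⟨_, ⟨a₀, ha₀, rfl⟩, hlt⟩ := Real.lt_sInf_add_pos
    (show (Q '' (A : Set B)).Nonempty from ⟨_, 0, A.zero_mem, rfl⟩) hσ
  obtain ⟨r, hr, hrσ, hra⟩ : ∃ r : ℝ, 0 < r ∧ r ≤ σ ∧ r * ‖a₀‖ ^ 2 ≤ σ := by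
    refine ⟨σ / (1 + ‖a₀‖ ^ 2), by positivity, div_le_self hσ.le (by nlinarith), ?_⟩
    rw [div_mul_eq_mul_div, div_le_iff₀ (by positivity)]
    nlinarith
  obtain ⟨a, ha, e, hp, hen, -, hmin⟩ :=
    exists_regularized_decomposition hL hA c hr (hrσ.trans hσ1) hr
  have hrr : r ^ 2 ≤ σ := by nlinarith
  have hra2 : r * ‖a‖ ^ 2 ≤ 6 * σ := by
    have h1 := hmin a₀ ha₀
    have h2 := csInf_le hbdd ⟨a, ha, rfl⟩
    simp only [hQ, qL_dual_sub hdual] at hlt h2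
    linarith
  have hna := norm_nonneg a
  have hne := norm_nonneg e
  have hra1 : r * ‖a‖ ≤ 3 * σ := by
    refine le_of_sq_le_sq ?_ (by positivity)
    nlinarith [mul_le_mul hrσ hra2 (by positivity) hσ.le]
  have he5 : ‖e‖ ≤ 5 * σ := by linarith
  have hea : ‖e‖ * ‖a‖ ≤ 12 * σ := by nlinarith
  have hee : ‖e‖ ^ 2 ≤ 25 * σ := by nlinarith
  have hec : ‖e‖ * ‖c‖ ≤ 5 * σ * ‖c‖ := by gcongr
  have hsplit := qL_add hdual.1 (c - L a) (-e)
  rw [← sub_eq_add_neg, qL_neg, map_neg] at hsplit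
  have hpn := hpolar _ hp
  have hcl : ‖c - L a‖ ≤ ‖c‖ + ‖a‖ := by
    have h := L.le_of_opNorm_le hL.1 a
    linarith [norm_sub_le c (L a)]
  have hpair := (le_abs_self _).trans (abs_apply_le_of_isSNMap hdual.1 (c - L a) e)
  have hpair2 : ‖c - L a‖ * ‖e‖ ≤ (‖c‖ + ‖a‖) * ‖e‖ := by gcongr
  have hqe := (neg_le_abs _).trans (abs_qL_le hdual.1 e)
  have hσc := mul_nonneg hσ.le hc
  have hfinal := hcon a ha
  rw [← neg_sub c, qL_neg] at hfinal
  linarith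

lemma maxLPos_neg_polarSet {L : B →L[ℝ] StrongDual ℝ B}
    {L' : StrongDual ℝ B →L[ℝ] StrongDual ℝ (StrongDual ℝ B)} (hL : IsSNMap L)
    (hdual : IsSNDual L L') {A : Submodule ℝ B} (hA : LPos L (A : Set B))
    (hpolar : LPos (-L') (polarSet (A : Set B))) : MaxLPos (-L') (polarSet (A : Set B)) := by
  refine ⟨hpolar, fun D hD hsub => (hsub.antisymm fun c hc d hd => ?_).symm⟩
  have hle : ∀ p ∈ polarSet (A : Set B), qL L' (c - p) ≤ 0 := fun p hp => by
    have h := hD.2 c hc p (hsub hp)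
    rw [qL_neg_map] at h
    linarith
  have key : ∀ η : ℝ, 0 < η → η ≤ 1 / 8 → |c d| ≤ (2 * √(16 * η) + 2 * η) * ‖d‖ := by
    intro η hη hη8
    obtain ⟨a, ha, e, hp, hen, hea, -⟩ :=
      exists_regularized_decomposition hL hA c one_pos le_rfl hη
    have h1 := hle _ hp
    rw [show c - (c - L a - e) = L a + e by abel, qL_dual_add hdual] at h1
    have h2 := hA.qL_nonneg ha
    have h3 := (neg_le_abs _).trans (abs_qL_le hdual.1 e)
    have hna := norm_nonneg a
    have h4 : ‖e‖ ^ 2 ≤ (1 * ‖a‖ + 2 * η) ^ 2 := by gcongr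
    have h5 : ‖a‖ ^ 2 ≤ 16 * η := by
      nlinarith [mul_nonneg hη.le (sq_nonneg (‖a‖ - 1)),
        mul_nonneg (sub_nonneg.2 hη8) (sq_nonneg ‖a‖)]
    have h6 : ‖a‖ ≤ √(16 * η) := Real.le_sqrt_of_sq_le h5
    have h7 : c d = (L a + e) d := by
      have h := hp d hd
      simp only [sub_apply, add_apply] at h ⊢
      linarith
    rw [h7]
    refine ((L a + e).le_opNorm d).trans ?_
    gcongr
    have h8 := L.le_of_opNorm_le hL.1 a
    linarith [norm_add_le (L a) e]
  have hlim : Filter.Tendsto (fun η : ℝ => (2 * √(16 * η) + 2 * η) * ‖d‖)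
      (nhdsWithin 0 (Set.Ioi 0)) (nhds 0) := by
    have hcont : Continuous fun η : ℝ => (2 * √(16 * η) + 2 * η) * ‖d‖ := by fun_prop
    simpa using (hcont.tendsto 0).mono_left nhdsWithin_le_nhds
  refine abs_nonpos_iff.1 (ge_of_tendsto hlim ?_)
  filter_upwards [Ioc_mem_nhdsGT (by norm_num : (0 : ℝ) < 1 / 8)] with η hη
  exact key η hη.1 hη.2

lemma exists_mem_polarSet_apply_pos {A : Submodule ℝ B} (hAc : IsClosed (A : Set B)) {b : B}
    (hb : b ∉ A) : ∃ p ∈ polarSet (A : Set B), 0 < p b := by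
  obtain ⟨f, u, hfA, hfb⟩ := geometric_hahn_banach_closed_point A.convex hAc hb
  have hu : 0 < u := by simpa using hfA 0 A.zero_mem
  refine ⟨f, fun a ha => ?_, hu.trans hfb⟩
  by_contra hfa
  have h := hfA ((u / f a) • a) (A.smul_mem _ ha)
  rw [map_smul, smul_eq_mul, div_mul_cancel₀ _ hfa] at h
  exact h.false

lemma maxLPos_of_inf_nonpos {L : B →L[ℝ] StrongDual ℝ B}
    {L' : StrongDual ℝ B →L[ℝ] StrongDual ℝ (StrongDual ℝ B)}
    (hdual : IsSNDual L L') {A : Submodule ℝ B} (hAc : IsClosed (A : Set B))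
    (hA : LPos L (A : Set B))
    (hinf : ∀ c : StrongDual ℝ B, ∀ ε > 0, ∃ a ∈ (A : Set B), qL L' (L a - c) < ε) :
    MaxLPos L (A : Set B) := by
  refine ⟨hA, fun C hC hsub => (hsub.antisymm fun b hbC => ?_).symm⟩
  by_contra hb
  obtain ⟨p, hp, hpb⟩ := exists_mem_polarSet_apply_pos hAc hb
  obtain ⟨t, ht, htq⟩ : ∃ t : ℝ, 0 < t ∧ 0 < t * p b + t ^ 2 * qL L' p := by
    refine ⟨p b / (|qL L' p| + 1), by positivity, ?_⟩
    have h : 0 < (p b / (|qL L' p| + 1)) ^ 2 * (|qL L' p| + 1 + qL L' p) := by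
      have := neg_abs_le (qL L' p)
      have : 0 < |qL L' p| + 1 + qL L' p := by linarith
      positivity
    convert h using 1
    field_simp
  obtain ⟨a, ha, hlt⟩ := hinf (L b + t • p) _ htq
  rw [show L a - (L b + t • p) = L (a - b) - t • p by rw [map_sub]; abel,
    qL_dual_sub hdual, qL_smul, smul_apply, map_sub, hp a ha, smul_eq_mul] at hlt
  have := hC.2 a (hsub ha) b hbC
  linarith

/-- Corollary 5.11. Let `A` be a closed linear `L`-positive subspace of `B`,
with `Λ := -L'`.  Then the following are equivalent: (i) `A⁰` is `Λ`-positive; (ii) `A` is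
maximally `L`-positive and `inf_{a ∈ A} q_{L'}(La - c*) ≤ 0` for all `c*`; (iii)
`inf_{a ∈ A} q_{L'}(La - c*) ≤ 0` for all `c*`; (iv) `A⁰` is maximally `Λ`-positive. -/
theorem polar_LambdaPos_tfae [CompleteSpace B] [Nontrivial B]
    (L : B →L[ℝ] StrongDual ℝ B) (L' : StrongDual ℝ B →L[ℝ] StrongDual ℝ (StrongDual ℝ B))
    (hL : IsSNMap L) (hdual : IsSNDual L L')
    (A : Submodule ℝ B) (hAc : IsClosed (A : Set B)) (hApos : LPos L (A : Set B)) :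
    (LPos (-L') (polarSet (A : Set B)) ↔
      (MaxLPos L (A : Set B) ∧
        ∀ c' : StrongDual ℝ B, sInf ((fun a => qL L' (L a - c')) '' (A : Set B)) ≤ 0)) ∧
    ((MaxLPos L (A : Set B) ∧
        ∀ c' : StrongDual ℝ B, sInf ((fun a => qL L' (L a - c')) '' (A : Set B)) ≤ 0) ↔
      (∀ c' : StrongDual ℝ B, sInf ((fun a => qL L' (L a - c')) '' (A : Set B)) ≤ 0)) ∧
    ((∀ c' : StrongDual ℝ B, sInf ((fun a => qL L' (L a - c')) '' (A : Set B)) ≤ 0) ↔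
      MaxLPos (-L') (polarSet (A : Set B))) := by
  simp only [sInf_image_nonpos_iff hApos.1]
  have h13 : LPos (-L') (polarSet (A : Set B)) →
      ∀ c' : StrongDual ℝ B, ∀ ε > 0, ∃ a ∈ (A : Set B), qL L' (L a - c') < ε :=
    fun h c' _ hε => exists_qL_dual_lt_of_polar_nonpos hL hdual hApos
      ((lPos_neg_polarSet_iff L' _).1 h) c' hε
  have h31 : (∀ c' : StrongDual ℝ B, ∀ ε > 0, ∃ a ∈ (A : Set B), qL L' (L a - c') < ε) →
      LPos (-L') (polarSet (A : Set B)) := by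
    refine fun h => (lPos_neg_polarSet_iff L' _).2 fun p hp => ?_
    refine le_of_forall_pos_le_add fun ε hε => ?_
    obtain ⟨a, ha, hlt⟩ := h p ε hε
    rw [qL_dual_sub hdual, hp a ha] at hlt
    linarith [hApos.qL_nonneg ha]
  have h32 := maxLPos_of_inf_nonpos hdual hAc hApos
  exact ⟨⟨fun h => ⟨h32 (h13 h), h13 h⟩, fun h => h31 h.2⟩, ⟨fun h => h.2, fun h => ⟨h32 h, h⟩⟩,
    ⟨fun h => maxLPos_neg_polarSet hL hdual hApos (h31 h), fun h => h13 h.1⟩⟩
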